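/- Define W_n(q) = Σ_{σ ∈ S_n(132,3241)} q^{inv(σ)} in ℤ[q]. Then W_0 = W_1 = 1 and, for every n ≥ 2, W_n(q) = (q^{n−1} + 1)·W_{n−1}(q) + Σ_{k=2}^{n−1} q^{k(n−k)} W_{n−k}(q). -/

import Mathlib

open Finset MvPolynomial

open scoped Classical

/-- `σ` (a permutation of `[n]` in one-line notation `σ 0, …, σ (n-1)`) contains the
pattern `π` (given by its one-line notation as a function `Fin m → Fin m`) if some
subsequence of `σ` is order isomorphic to `π`. -/
def PermContains {n m : ℕ} (σ : Equiv.Perm (Fin n)) (π : Fin m → Fin m) : Prop :=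
  ∃ f : Fin m → Fin n, (∀ a b : Fin m, a < b → f a < f b) ∧
    ∀ a b : Fin m, σ (f a) < σ (f b) ↔ π a < π b

/-- `σ` avoids the pattern `π`. -/
def PermAvoids {n m : ℕ} (σ : Equiv.Perm (Fin n)) (π : Fin m → Fin m) : Prop :=
  ¬ PermContains σ π

/-- The value `σ i` of the one-line notation of `σ`, as a natural number (0-based). -/
def permVal {n : ℕ} (σ : Equiv.Perm (Fin n)) (i : ℕ) : ℕ :=
  if h : i < n then (σ ⟨i, h⟩ : ℕ) else 0

/-- `inv σ` : the number of inversions, i.e. pairs of positions `i < j` with `σ i > σ j`. -/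
def invStat {n : ℕ} (σ : Equiv.Perm (Fin n)) : ℕ :=
  ((Finset.range n ×ˢ Finset.range n).filter
    fun p => p.1 < p.2 ∧ permVal σ p.2 < permVal σ p.1).card

/-- `maj σ` : the sum of all (1-based) indices `i` with `σ(i) > σ(i+1)`; with 0-based
positions, a descent at positions `i, i+1` contributes `i + 1`. -/
def majStat {n : ℕ} (σ : Equiv.Perm (Fin n)) : ℕ :=
  ∑ i ∈ Finset.range (n - 1), if permVal σ (i + 1) < permVal σ i then i + 1 else 0

/-- The number of ascents of `σ`; for `σ ∈ Sₙ(123,132,213)` (a reverse layered matching)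
this equals `d σ`, the number of doubleton blocks. -/
def ascStat {n : ℕ} (σ : Equiv.Perm (Fin n)) : ℕ :=
  ((Finset.range (n - 1)).filter fun i => permVal σ i < permVal σ (i + 1)).card

/-- The number of descents of `σ`; for `σ ∈ Sₙ(231,312,321)` (a layered matching)
this equals `d σ`, the number of doubleton blocks. -/
def descStat {n : ℕ} (σ : Equiv.Perm (Fin n)) : ℕ :=
  ((Finset.range (n - 1)).filter fun i => permVal σ (i + 1) < permVal σ i).card

/-- `Sₙ(123, 132, 213)` : permutations of `[n]` avoiding `123`, `132` and `213`
(patterns written 0-based). -/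
noncomputable def S123 (n : ℕ) : Finset (Equiv.Perm (Fin n)) :=
  Finset.univ.filter fun σ =>
    PermAvoids σ ![0, 1, 2] ∧ PermAvoids σ ![0, 2, 1] ∧ PermAvoids σ ![1, 0, 2]

/-- `Sₙ(231, 312, 321)` : permutations of `[n]` avoiding `231`, `312` and `321`
(patterns written 0-based). -/
noncomputable def S231 (n : ℕ) : Finset (Equiv.Perm (Fin n)) :=
  Finset.univ.filter fun σ =>
    PermAvoids σ ![1, 2, 0] ∧ PermAvoids σ ![2, 0, 1] ∧ PermAvoids σ ![2, 1, 0]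

/-- `Sₙ(132, 3241)` : permutations of `[n]` avoiding `132` and `3241`
(patterns written 0-based). -/
noncomputable def S132_3241 (n : ℕ) : Finset (Equiv.Perm (Fin n)) :=
  Finset.univ.filter fun σ => PermAvoids σ ![0, 2, 1] ∧ PermAvoids σ ![2, 1, 3, 0]

/-- `Wₙ(q) = Σ_{σ ∈ Sₙ(132,3241)} q^(inv σ)` in `ℤ[q]`. -/
noncomputable def W (n : ℕ) : Polynomial ℤ := ∑ σ ∈ S132_3241 n, Polynomial.X ^ invStat σ

theorem permVal_lt {n : ℕ} (σ : Equiv.Perm (Fin n)) {i : ℕ} (hi : i < n) : permVal σ i < n := by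
  simp [permVal, hi]

theorem permVal_inj {n : ℕ} (σ : Equiv.Perm (Fin n)) {i k : ℕ} (hi : i < n) (hk : k < n)
    (h : permVal σ i = permVal σ k) : i = k := by
  simpa [permVal, hi, hk, Fin.val_inj] using h

theorem perm_ext_permVal {n : ℕ} {σ τ : Equiv.Perm (Fin n)}
    (h : ∀ i < n, permVal σ i = permVal τ i) : σ = τ := by
  ext i
  simpa [permVal] using h i i.2

theorem exists_permVal_eq {n : ℕ} (g : ℕ → ℕ) (hg : ∀ i < n, g i < n)
    (hinj : ∀ i < n, ∀ k < n, g i = g k → i = k) :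
    ∃ σ : Equiv.Perm (Fin n), ∀ i < n, permVal σ i = g i := by
  let f : Fin n → Fin n := fun i => ⟨g i, hg i i.2⟩
  have hf : Function.Injective f := fun a b hab =>
    Fin.ext (hinj a a.2 b b.2 (by simpa [f] using hab))
  refine ⟨Equiv.ofBijective f (Finite.injective_iff_bijective.1 hf), fun i hi => ?_⟩
  simp [permVal, hi, f]

theorem permAvoids_132_iff {n : ℕ} (σ : Equiv.Perm (Fin n)) :
    PermAvoids σ ![0, 2, 1] ↔ ∀ a b c, a < b → b < c → c < n →
      permVal σ a < permVal σ c → permVal σ c < permVal σ b → False := by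
  constructor
  · intro h a b c hab hbc hc h1 h2
    have hb : b < n := hbc.trans hc
    have ha : a < n := hab.trans hb
    simp only [permVal, ha, hb, hc, dif_pos] at h1 h2
    refine h ⟨![⟨a, ha⟩, ⟨b, hb⟩, ⟨c, hc⟩], ?_, ?_⟩
    · simp [Fin.forall_fin_succ]
      omega
    · simp [Fin.forall_fin_succ]
      simp only [Fin.lt_def, Fin.le_def]
      omega
  · rintro h ⟨f, hf, hσ⟩
    refine h (f 0) (f 1) (f 2) (hf 0 1 (by decide)) (hf 1 2 (by decide)) (f 2).2 ?_ ?_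
    · simpa [permVal] using (hσ 0 2).2 (by decide)
    · simpa [permVal] using (hσ 2 1).2 (by decide)

theorem permAvoids_3241_iff {n : ℕ} (σ : Equiv.Perm (Fin n)) :
    PermAvoids σ ![2, 1, 3, 0] ↔ ∀ a b c d, a < b → b < c → c < d → d < n →
      permVal σ d < permVal σ b → permVal σ b < permVal σ a →
      permVal σ a < permVal σ c → False := by
  constructor
  · intro h a b c d hab hbc hcd hd h1 h2 h3
    have hc : c < n := hcd.trans hd
    have hb : b < n := hbc.trans hc
    have ha : a < n := hab.trans hb
    simp only [permVal, ha, hb, hc, hd, dif_pos] at h1 h2 h3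
    refine h ⟨![⟨a, ha⟩, ⟨b, hb⟩, ⟨c, hc⟩, ⟨d, hd⟩], ?_, ?_⟩
    · simp [Fin.forall_fin_succ]
      omega
    · simp [Fin.forall_fin_succ]
      simp only [Fin.lt_def, Fin.le_def]
      omega
  · rintro h ⟨f, hf, hσ⟩
    refine h (f 0) (f 1) (f 2) (f 3) (hf 0 1 (by decide)) (hf 1 2 (by decide))
      (hf 2 3 (by decide)) (f 3).2 ?_ ?_ ?_
    · simpa [permVal] using (hσ 3 1).2 (by decide)
    · simpa [permVal] using (hσ 1 0).2 (by decide)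
    · simpa [permVal] using (hσ 0 2).2 (by decide)

theorem mem_S132_3241_iff {n : ℕ} (σ : Equiv.Perm (Fin n)) :
    σ ∈ S132_3241 n ↔
      (∀ a b c, a < b → b < c → c < n →
        permVal σ a < permVal σ c → permVal σ c < permVal σ b → False) ∧
      (∀ a b c d, a < b → b < c → c < d → d < n →
        permVal σ d < permVal σ b → permVal σ b < permVal σ a →
        permVal σ a < permVal σ c → False) := by
  simp [S132_3241, permAvoids_132_iff, permAvoids_3241_iff]

theorem invStat_eq_sum {n : ℕ} (σ : Equiv.Perm (Fin n)) :
    invStat σ = ∑ i ∈ range n, ∑ k ∈ range n,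
      if i < k ∧ permVal σ k < permVal σ i then 1 else 0 := by
  rw [invStat, Finset.card_filter, Finset.sum_product]

/-- `σ` is `τ` followed by the new maximum. -/
def IsAppendMax {m : ℕ} (τ : Equiv.Perm (Fin m)) (σ : Equiv.Perm (Fin (m + 1))) : Prop :=
  (∀ i < m, permVal σ i = permVal τ i) ∧ permVal σ m = m

/-- `σ` is the increasing sequence of its `j` largest values followed by `τ`. -/
def IsPrependTop {j r n : ℕ} (τ : Equiv.Perm (Fin r)) (σ : Equiv.Perm (Fin n)) : Prop :=
  n = j + r ∧ (∀ i < j, permVal σ i = r + i) ∧ ∀ i < r, permVal σ (j + i) = permVal τ i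

theorem exists_isAppendMax {m : ℕ} (τ : Equiv.Perm (Fin m)) :
    ∃ σ, IsAppendMax τ σ := by
  obtain ⟨σ, hσ⟩ := exists_permVal_eq (n := m + 1)
    (fun i => if i < m then permVal τ i else m)
    (fun i hi => by
      split_ifs with h
      · exact (permVal_lt τ h).trans (Nat.lt_succ_self m)
      · exact Nat.lt_succ_self m)
    (fun i hi k hk h => by
      split_ifs at h with h1 h2 h2
      · exact permVal_inj τ h1 h2 h
      · have := permVal_lt τ h1
        omega
      · have := permVal_lt τ h2
        omega
      · omega)
  exact ⟨σ, fun i hi => by simp [hσ i (by omega), hi], by simp [hσ m (by omega)]⟩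

theorem exists_isPrependTop (j : ℕ) {r : ℕ} (τ : Equiv.Perm (Fin r)) :
    ∃ σ : Equiv.Perm (Fin (j + r)), IsPrependTop (j := j) τ σ := by
  obtain ⟨σ, hσ⟩ := exists_permVal_eq (n := j + r)
    (fun i => if i < j then r + i else permVal τ (i - j))
    (fun i hi => by
      split_ifs with h
      · omega
      · have := permVal_lt τ (i := i - j) (by omega)
        omega)
    (fun i hi k hk h => by
      split_ifs at h with h1 h2 h2
      · omega
      · have := permVal_lt τ (i := k - j) (by omega)
        omega
      · have := permVal_lt τ (i := i - j) (by omega)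
        omega
      · have := permVal_inj τ (by omega) (by omega) h
        omega)
  exact ⟨σ, rfl, fun i hi => by simp [hσ i (by omega), hi],
    fun i hi => by simp [hσ (j + i) (by omega)]⟩

namespace IsAppendMax

variable {m : ℕ} {τ τ' : Equiv.Perm (Fin m)} {σ : Equiv.Perm (Fin (m + 1))}

theorem injective (h : IsAppendMax τ σ) (h' : IsAppendMax τ' σ) : τ = τ' :=
  perm_ext_permVal fun i hi => (h.1 i hi).symm.trans (h'.1 i hi)

theorem exists_of_permVal_eq (h : permVal σ m = m) : ∃ τ, IsAppendMax τ σ := by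
  obtain ⟨τ, hτ⟩ := exists_permVal_eq (n := m) (permVal σ)
    (fun i hi => by
      have h1 := permVal_lt σ (i := i) (by omega)
      have h2 : permVal σ i ≠ permVal σ m := fun e => by
        have := permVal_inj σ (by omega) (by omega) e
        omega
      omega)
    (fun i hi k hk => permVal_inj σ (by omega) (by omega))
  exact ⟨τ, fun i hi => (hτ i hi).symm, h⟩

theorem mem_iff (h : IsAppendMax τ σ) : τ ∈ S132_3241 m ↔ σ ∈ S132_3241 (m + 1) := by
  obtain ⟨h1, h2⟩ := h
  have hlt : ∀ i ≤ m, permVal σ i ≤ m := fun i hi =>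
    Nat.lt_succ_iff.1 (permVal_lt σ (by omega))
  simp only [mem_S132_3241_iff]
  constructor
  · rintro ⟨hA, hB⟩
    refine ⟨fun a b c hab hbc hc => ?_, fun a b c d hab hbc hcd hd => ?_⟩
    · rcases Nat.lt_or_ge c m with hcm | hcm
      · rw [h1 a (by omega), h1 b (by omega), h1 c hcm]
        exact hA a b c hab hbc hcm
      · obtain rfl : c = m := by omega
        have := hlt b (by omega)
        omega
    · rcases Nat.lt_or_ge d m with hdm | hdm
      · rw [h1 a (by omega), h1 b (by omega), h1 c (by omega), h1 d hdm]
        exact hB a b c d hab hbc hcd hdm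
      · obtain rfl : d = m := by omega
        have := hlt b (by omega)
        omega
  · rintro ⟨hA, hB⟩
    refine ⟨fun a b c hab hbc hc => ?_, fun a b c d hab hbc hcd hd => ?_⟩
    · rw [← h1 a (by omega), ← h1 b (by omega), ← h1 c hc]
      exact hA a b c hab hbc (by omega)
    · rw [← h1 a (by omega), ← h1 b (by omega), ← h1 c (by omega), ← h1 d hd]
      exact hB a b c d hab hbc hcd (by omega)

theorem invStat_eq (h : IsAppendMax τ σ) : invStat σ = invStat τ := by
  obtain ⟨h1, h2⟩ := h
  rw [invStat_eq_sum, invStat_eq_sum, Finset.sum_range_succ]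
  rw [Finset.sum_eq_zero (s := range (m + 1)) (fun k hk => ?_), add_zero]
  · refine Finset.sum_congr rfl fun i hi => ?_
    rw [mem_range] at hi
    rw [Finset.sum_range_succ, if_neg, add_zero]
    · refine Finset.sum_congr rfl fun k hk => ?_
      rw [mem_range] at hk
      rw [h1 i hi, h1 k hk]
    · have := permVal_lt σ (i := i) (by omega)
      omega
  · rw [mem_range] at hk
    rw [if_neg (by omega)]

end IsAppendMax

namespace IsPrependTop

variable {j r n : ℕ} {τ τ' : Equiv.Perm (Fin r)} {σ : Equiv.Perm (Fin n)}

theorem injective (h : IsPrependTop (j := j) τ σ) (h' : IsPrependTop (j := j) τ' σ) : τ = τ' :=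
  perm_ext_permVal fun i hi => (h.2.2 i hi).symm.trans (h'.2.2 i hi)

theorem mem_of_mem (h : IsPrependTop (j := j) τ σ) (hσ : σ ∈ S132_3241 n) :
    τ ∈ S132_3241 r := by
  obtain ⟨rfl, -, h2⟩ := h
  rw [mem_S132_3241_iff] at hσ ⊢
  obtain ⟨hA, hB⟩ := hσ
  refine ⟨fun a b c hab hbc hc => ?_, fun a b c d hab hbc hcd hd => ?_⟩
  · rw [← h2 a (by omega), ← h2 b (by omega), ← h2 c hc]
    exact hA _ _ _ (by omega) (by omega) (by omega)
  · rw [← h2 a (by omega), ← h2 b (by omega), ← h2 c (by omega), ← h2 d hd]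
    exact hB _ _ _ _ (by omega) (by omega) (by omega) (by omega)

theorem mem_of_mem' (h : IsPrependTop (j := j) τ σ) (hτ : τ ∈ S132_3241 r) :
    σ ∈ S132_3241 n := by
  obtain ⟨rfl, h1, h2⟩ := h
  have key : ∀ i < j + r, (i < j ∧ permVal σ i = r + i) ∨
      ∃ k < r, i = j + k ∧ permVal σ i < r := fun i hi => by
    rcases Nat.lt_or_ge i j with hij | hij
    · exact Or.inl ⟨hij, h1 i hij⟩
    · obtain ⟨k, rfl⟩ := Nat.exists_eq_add_of_le hij
      exact Or.inr ⟨k, by omega, rfl, by rw [h2 k (by omega)]; exact permVal_lt τ (by omega)⟩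
  rw [mem_S132_3241_iff] at hτ ⊢
  obtain ⟨hA, hB⟩ := hτ
  refine ⟨fun a b c hab hbc hc x y => ?_, fun a b c d hab hbc hcd hd x y z => ?_⟩
  · rcases key a (by omega) with ⟨ha, ha'⟩ | ⟨a, ha, rfl, ha'⟩
    · rcases key b (by omega) with ⟨hb, hb'⟩ | ⟨b, hb, rfl, hb'⟩ <;>
        rcases key c (by omega) with ⟨hc, hc'⟩ | ⟨c, hc, rfl, hc'⟩ <;> omega
    · obtain ⟨b, rfl⟩ := Nat.exists_eq_add_of_le (show j ≤ b by omega)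
      obtain ⟨c, rfl⟩ := Nat.exists_eq_add_of_le (show j ≤ c by omega)
      rw [h2 _ (by omega), h2 _ (by omega)] at x y
      exact hA a b c (by omega) (by omega) (by omega) x y
  · rcases key a (by omega) with ⟨ha, ha'⟩ | ⟨a, ha, rfl, ha'⟩
    · rcases key b (by omega) with ⟨hb, hb'⟩ | ⟨b, hb, rfl, hb'⟩ <;>
        rcases key c (by omega) with ⟨hc, hc'⟩ | ⟨c, hc, rfl, hc'⟩ <;> omega
    · obtain ⟨b, rfl⟩ := Nat.exists_eq_add_of_le (show j ≤ b by omega)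
      obtain ⟨c, rfl⟩ := Nat.exists_eq_add_of_le (show j ≤ c by omega)
      obtain ⟨d, rfl⟩ := Nat.exists_eq_add_of_le (show j ≤ d by omega)
      rw [h2 _ (by omega), h2 _ (by omega)] at x y z
      exact hB a b c d (by omega) (by omega) (by omega) (by omega) x y z

theorem invStat_eq (h : IsPrependTop (j := j) τ σ) : invStat σ = j * r + invStat τ := by
  obtain ⟨rfl, h1, h2⟩ := h
  rw [invStat_eq_sum, invStat_eq_sum, Finset.sum_range_add]
  congr 1
  · rw [Finset.sum_eq_card_nsmul (b := r)]
    · simp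
    · intro i hi
      rw [mem_range] at hi
      rw [Finset.sum_range_add, Finset.sum_eq_zero, zero_add,
        Finset.sum_eq_card_nsmul (b := 1)]
      · simp
      · intro k hk
        rw [mem_range] at hk
        have := permVal_lt τ hk
        rw [h1 i hi, h2 k hk, if_pos (by omega)]
      · intro k hk
        rw [mem_range] at hk
        rw [h1 i hi, h1 k hk, if_neg (by omega)]
  · refine Finset.sum_congr rfl fun i hi => ?_
    rw [mem_range] at hi
    rw [Finset.sum_range_add, Finset.sum_eq_zero, zero_add]
    · refine Finset.sum_congr rfl fun k hk => ?_
      rw [mem_range] at hk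
      rw [h2 i hi, h2 k hk]
      simp
    · intro k hk
      rw [mem_range] at hk
      rw [if_neg (by omega)]

theorem exists_of_mem {p m : ℕ} {σ : Equiv.Perm (Fin (m + 1))} (hp : p < m)
    (hσ : σ ∈ S132_3241 (m + 1)) (hmax : permVal σ p = m) :
    ∃ τ : Equiv.Perm (Fin (m - p)), IsPrependTop (j := p + 1) τ σ := by
  rw [mem_S132_3241_iff] at hσ
  obtain ⟨hA, hB⟩ := hσ
  have hne : ∀ i ≤ m, ∀ k ≤ m, i ≠ k → permVal σ i ≠ permVal σ k := fun i hi k hk hik e =>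
    hik (permVal_inj σ (by omega) (by omega) e)
  have hlt : ∀ i ≤ m, i ≠ p → permVal σ i < m := fun i hi hip => by
    have h1 := permVal_lt σ (i := i) (by omega)
    have h2 := hne i hi p hp.le hip
    omega
  have htop : ∀ i ≤ p, ∀ k, p < k → k ≤ m → permVal σ k < permVal σ i := by
    intro i hi k hk hkm
    rcases eq_or_lt_of_le hi with rfl | hi
    · rw [hmax]
      exact hlt k hkm (by omega)
    · have h1 := hne i (by omega) k hkm (by omega)
      have h2 := hlt k hkm (by omega)
      by_contra h3
      exact hA i p k hi hk (by omega) (by omega) (by omega)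
  have hmono : ∀ i k, i < k → k ≤ p → permVal σ i < permVal σ k := by
    intro i k hik hk
    rcases eq_or_lt_of_le hk with rfl | hk
    · rw [hmax]
      exact hlt i (by omega) (by omega)
    · have h1 := hne i (by omega) k (by omega) (by omega)
      have h2 := hlt i (by omega) (by omega)
      have h3 := htop k hk.le m hp le_rfl
      by_contra h4
      exact hB i k p m hik hk hp (by omega) h3 (by omega) (by omega)
  have hgap : ∀ d i, i + d ≤ p → permVal σ i + d ≤ permVal σ (i + d) := by
    intro d
    induction d with
    | zero => simp
    | succ d ih =>
      intro i hi
      have h1 := ih i (by omega)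
      have h2 := hmono (i + d) (i + d + 1) (by omega) (by omega)
      rw [← add_assoc i d 1]
      omega
  have hzero : m - p ≤ permVal σ 0 := by
    have hf : Function.Injective
        (fun i : Fin (m - p) => (⟨permVal σ (p + 1 + i),
          htop 0 (by omega) _ (by omega) (by omega)⟩ : Fin (permVal σ 0))) := by
      intro a b hab
      have := permVal_inj σ (by omega) (by omega) (Fin.mk.inj hab)
      omega
    simpa using Fintype.card_le_of_injective _ hf
  have hval : ∀ i < p + 1, permVal σ i = m - p + i := by
    intro i hi
    have h1 := hgap i 0 (by omega)
    have h2 := hgap (p - i) i (by omega)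
    rw [zero_add] at h1
    rw [show i + (p - i) = p by omega, hmax] at h2
    omega
  obtain ⟨τ, hτ⟩ := exists_permVal_eq (n := m - p) (fun i => permVal σ (p + 1 + i))
    (fun i hi => by
      have h1 := htop 0 (by omega) (p + 1 + i) (by omega) (by omega)
      rw [hval 0 (by omega)] at h1
      simpa using h1)
    (fun i hi k hk e => by
      have := permVal_inj σ (by omega) (by omega) e
      omega)
  exact ⟨τ, by omega, hval, fun i hi => (hτ i hi).symm⟩

end IsPrependTop

theorem sum_permVal_last_eq (m : ℕ) :
    ∑ σ ∈ S132_3241 (m + 1) with permVal σ m = m, (Polynomial.X : Polynomial ℤ) ^ invStat σ =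
      W m := by
  choose f hf using fun τ : Equiv.Perm (Fin m) => exists_isAppendMax τ
  symm
  refine Finset.sum_nbij f (fun τ hτ => ?_) (fun τ _ τ' _ h => ?_) (fun σ hσ => ?_)
    (fun τ _ => by rw [(hf τ).invStat_eq])
  · exact mem_filter.2 ⟨(hf τ).mem_iff.1 hτ, (hf τ).2⟩
  · exact (hf τ).injective (h ▸ hf τ')
  · obtain ⟨hσ, hm⟩ := mem_filter.1 hσ
    obtain ⟨τ, hτ⟩ := IsAppendMax.exists_of_permVal_eq hm
    refine ⟨τ, hτ.mem_iff.2 hσ, perm_ext_permVal fun i hi => ?_⟩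
    rcases Nat.lt_succ_iff_lt_or_eq.1 hi with hi | rfl
    · rw [(hf τ).1 i hi, hτ.1 i hi]
    · rw [(hf τ).2, hτ.2]

theorem sum_permVal_eq_of_lt {m p : ℕ} (hp : p < m) :
    ∑ σ ∈ S132_3241 (m + 1) with permVal σ p = m, (Polynomial.X : Polynomial ℤ) ^ invStat σ =
      Polynomial.X ^ ((p + 1) * (m - p)) * W (m - p) := by
  have hex : ∀ τ : Equiv.Perm (Fin (m - p)), ∃ σ : Equiv.Perm (Fin (m + 1)),
      IsPrependTop (j := p + 1) τ σ := fun τ => by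
    obtain ⟨σ, hσ⟩ := exists_isPrependTop (p + 1) τ
    have e : p + 1 + (m - p) = m + 1 := by omega
    rw [← e]
    exact ⟨σ, hσ⟩
  choose f hf using hex
  rw [W, Finset.mul_sum]
  symm
  refine Finset.sum_nbij f (fun τ hτ => ?_) (fun τ _ τ' _ h => ?_) (fun σ hσ => ?_)
    (fun τ _ => by rw [(hf τ).invStat_eq, pow_add])
  · refine mem_filter.2 ⟨(hf τ).mem_of_mem' hτ, ?_⟩
    rw [(hf τ).2.1 p (by omega)]
    omega
  · exact (hf τ).injective (h ▸ hf τ')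
  · obtain ⟨hσ, hm⟩ := mem_filter.1 hσ
    obtain ⟨τ, hτ⟩ := IsPrependTop.exists_of_mem hp hσ hm
    refine ⟨τ, hτ.mem_of_mem hσ, perm_ext_permVal fun i hi => ?_⟩
    rcases Nat.lt_or_ge i (p + 1) with hip | hip
    · rw [(hf τ).2.1 i hip, hτ.2.1 i hip]
    · obtain ⟨k, rfl⟩ := Nat.exists_eq_add_of_le hip
      rw [(hf τ).2.2 k (by omega), hτ.2.2 k (by omega)]

theorem W_succ (m : ℕ) :
    W (m + 1) = W m +
      ∑ p ∈ range m, Polynomial.X ^ ((p + 1) * (m - p)) * W (m - p) := by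
  have hpos : ∀ σ : Equiv.Perm (Fin (m + 1)), ∀ p < m + 1,
      ((σ.symm (Fin.last m) : ℕ) = p ↔ permVal σ p = m) := fun σ p hp => by
    have h : permVal σ p = m ↔ σ ⟨p, hp⟩ = Fin.last m := by simp [permVal, hp, Fin.ext_iff]
    rw [h, ← Equiv.eq_symm_apply, Fin.ext_iff, eq_comm]
  rw [W, ← Finset.sum_fiberwise_of_maps_to (t := range (m + 1))
    (g := fun σ : Equiv.Perm (Fin (m + 1)) => (σ.symm (Fin.last m) : ℕ))
    (fun σ _ => mem_range.2 (σ.symm (Fin.last m)).2), Finset.sum_range_succ, add_comm]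
  congr 1
  · rw [← sum_permVal_last_eq]
    exact Finset.sum_congr (Finset.filter_congr fun σ _ => hpos σ m (by omega)) fun _ _ => rfl
  · refine Finset.sum_congr rfl fun p hp => ?_
    rw [mem_range] at hp
    rw [← sum_permVal_eq_of_lt hp]
    exact Finset.sum_congr (Finset.filter_congr fun σ _ => hpos σ p (by omega)) fun _ _ => rfl

theorem W_zero : W 0 = 1 := by
  have h : S132_3241 0 = Finset.univ := by
    ext σ
    simp only [mem_S132_3241_iff, Finset.mem_univ, iff_true]
    exact ⟨fun _ _ c _ _ hc => absurd hc c.not_lt_zero,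
      fun _ _ _ d _ _ _ hd => absurd hd d.not_lt_zero⟩
  simp [W, h, invStat]

/-- `W₀ = W₁ = 1` and, for `n ≥ 2`,
`Wₙ(q) = (q^(n-1) + 1) W_{n-1}(q) + Σ_{k=2}^{n-1} q^(k(n-k)) W_{n-k}(q)`. -/
theorem stmt18 :
    W 0 = 1 ∧ W 1 = 1 ∧
      ∀ n : ℕ, 2 ≤ n →
        W n = (Polynomial.X ^ (n - 1) + 1) * W (n - 1) +
          ∑ k ∈ Finset.Icc 2 (n - 1), Polynomial.X ^ (k * (n - k)) * W (n - k) := by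
  refine ⟨W_zero, by simp [W_succ, W_zero], fun n hn => ?_⟩
  obtain ⟨m, rfl⟩ := Nat.exists_eq_add_of_le' hn
  rw [show m + 2 = m + 1 + 1 from rfl, W_succ, Finset.sum_range_succ']
  have h : ∑ k ∈ Finset.Icc 2 (m + 1),
      (Polynomial.X : Polynomial ℤ) ^ (k * (m + 1 + 1 - k)) * W (m + 1 + 1 - k) =
      ∑ p ∈ range m, Polynomial.X ^ ((p + 1 + 1) * (m + 1 - (p + 1))) * W (m + 1 - (p + 1)) := by
    rw [← Finset.Ico_add_one_right_eq_Icc, Finset.sum_Ico_eq_sum_range]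
    refine Finset.sum_congr (by simp) fun p _ => ?_
    rw [show m + 1 + 1 - (2 + p) = m + 1 - (p + 1) by omega, show 2 + p = p + 1 + 1 by omega]
  rw [show m + 1 + 1 - 1 = m + 1 from rfl, h]
  simp only [zero_add, one_mul, Nat.sub_zero]
  ring
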